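/- arXiv:2303.00076 — 2 statements merged into one kernel-verified Lean document; each statement's English description precedes it below -/
import Mathlib

section
/- Let i, j be positive integers such that both i/gcd(i,j) and j/gcd(i,j) are odd. Then |3·⟨𝒮_i, 𝒮_j⟩| = gcd(i,j)⁴/(i²·j²), and the sign of ⟨𝒮_i, 𝒮_j⟩ is negative if and only if (i+j)/(2·gcd(i,j)) is an even integer. In particular, ⟨𝒮_i, 𝒮_i⟩ = 1/3 for every i ∈ ℕ. -/
open MeasureTheory Filter Topology

/-- The 1-periodic piecewise linear "cosine-like" function:
`𝒞(x) = 4|x - 1/2| - 1` on `[0,1]`, extended by `𝒞(x) = 𝒞(x - ⌊x⌋)`. -/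
noncomputable def Cfun (x : ℝ) : ℝ := 4 * |Int.fract x - 1 / 2| - 1

/-- The 1-periodic piecewise linear "sine-like" function:
`𝒮(x) = |2 - 4|x - 1/4|| - 1` on `[0,1]`, extended by `𝒮(x) = 𝒮(x - ⌊x⌋)`. -/
noncomputable def Sfun (x : ℝ) : ℝ := abs (2 - 4 * |Int.fract x - 1 / 4|) - 1

/-- The second Bernoulli polynomial made `1`-periodic. -/
noncomputable def bernoulliTwoFract (x : ℝ) : ℝ := Int.fract x ^ 2 - Int.fract x + 1 / 6

theorem bernoulliTwoFract_periodic : Function.Periodic bernoulliTwoFract 1 := fun x => by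
  simp [bernoulliTwoFract]

theorem Sfun_periodic : Function.Periodic Sfun 1 := fun x => by
  simp [Sfun]

theorem continuous_Sfun : Continuous Sfun := by
  have h : ContinuousOn (fun t : ℝ => abs (2 - 4 * |t - 1 / 4|) - 1) (Set.Icc 0 1) := by
    fun_prop
  exact h.comp_fract'' (by norm_num [abs_of_nonneg, abs_of_nonpos])

theorem Sfun_eq_of_le {x : ℝ} (h0 : 0 ≤ x) (h1 : x ≤ 1 / 4) : Sfun x = 4 * x := by
  rw [Sfun, Int.fract_eq_self.2 ⟨h0, by linarith⟩, abs_of_nonpos (by linarith : x - 1 / 4 ≤ 0),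
    abs_of_nonneg (by linarith)]
  ring

theorem Sfun_eq_of_mem_middle {x : ℝ} (h0 : 1 / 4 ≤ x) (h1 : x ≤ 3 / 4) :
    Sfun x = 2 - 4 * x := by
  rw [Sfun, Int.fract_eq_self.2 ⟨by linarith, by linarith⟩,
    abs_of_nonneg (by linarith : 0 ≤ x - 1 / 4), abs_of_nonneg (by linarith)]
  ring

theorem Sfun_eq_of_ge {x : ℝ} (h0 : 3 / 4 ≤ x) (h1 : x ≤ 1) : Sfun x = 4 * x - 4 := by
  rcases h1.eq_or_lt with rfl | h1
  · norm_num [Sfun, abs_of_nonneg, abs_of_nonpos]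
  rw [Sfun, Int.fract_eq_self.2 ⟨by linarith, h1⟩,
    abs_of_nonneg (by linarith : 0 ≤ x - 1 / 4), abs_of_nonpos (by linarith)]
  ring

theorem Sfun_eq_bernoulliTwoFract_sub (x : ℝ) :
    Sfun x = 4 * (bernoulliTwoFract (x - 1 / 4) - bernoulliTwoFract (x + 1 / 4)) := by
  have hper : Function.Periodic
      (fun x => 4 * (bernoulliTwoFract (x - 1 / 4) - bernoulliTwoFract (x + 1 / 4))) 1 := by
    intro x
    have e1 : x + 1 - 1 / 4 = x - 1 / 4 + 1 := by ring
    have e2 : x + 1 + 1 / 4 = x + 1 / 4 + 1 := by ring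
    beta_reduce
    rw [e1, e2, bernoulliTwoFract_periodic, bernoulliTwoFract_periodic]
  have hfract {f : ℝ → ℝ} (hf : Function.Periodic f 1) : f x = f (Int.fract x) := by
    simpa only [mul_one, Int.self_sub_floor] using (hf.sub_int_mul_eq (x := x) ⌊x⌋).symm
  rw [hfract Sfun_periodic, hfract hper]
  have h0 := Int.fract_nonneg x
  have h1 := Int.fract_lt_one x
  generalize Int.fract x = t at h0 h1
  have key (u : ℝ) (n : ℤ) (hu : 0 ≤ u - n) (hu' : u - n < 1) : Int.fract u = u - n :=
    Int.fract_eq_iff.2 ⟨hu, hu', n, by ring⟩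
  simp only [bernoulliTwoFract]
  rcases lt_or_ge t (1 / 4) with ht | ht
  · rw [Sfun_eq_of_le h0 ht.le, key (t - 1 / 4) (-1) (by norm_num; linarith)
      (by norm_num; linarith), key (t + 1 / 4) 0 (by norm_num; linarith) (by norm_num; linarith)]
    push_cast
    ring
  rcases lt_or_ge t (3 / 4) with ht' | ht'
  · rw [Sfun_eq_of_mem_middle ht ht'.le, key (t - 1 / 4) 0 (by norm_num; linarith)
      (by norm_num; linarith), key (t + 1 / 4) 0 (by norm_num; linarith) (by norm_num; linarith)]
    push_cast
    ring
  · rw [Sfun_eq_of_ge ht' h1.le, key (t - 1 / 4) 0 (by norm_num; linarith)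
      (by norm_num; linarith), key (t + 1 / 4) 1 (by norm_num; linarith) (by norm_num; linarith)]
    push_cast
    ring

theorem sum_bernoulliTwoFract_add_div {a : ℕ} (ha : 0 < a) (y : ℝ) :
    ∑ k ∈ Finset.range a, bernoulliTwoFract (y + k / a) = bernoulliTwoFract (a * y) / a := by
  have ha' : (0 : ℝ) < a := by exact_mod_cast ha
  have hper : Function.Periodic
      (fun y : ℝ => ∑ k ∈ Finset.range a, bernoulliTwoFract (y + k / a)) (1 / a) := by
    intro y
    have h := (Finset.sum_range_succ (fun k : ℕ => bernoulliTwoFract (y + k / a)) a).symm.trans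
      (Finset.sum_range_succ' (fun k : ℕ => bernoulliTwoFract (y + k / a)) a)
    rw [div_self ha'.ne', bernoulliTwoFract_periodic] at h
    simp only [Nat.cast_zero, zero_div, add_zero, add_left_inj] at h
    simp only [h]
    refine Finset.sum_congr rfl fun k _ => ?_
    push_cast
    ring_nf
  have h := hper.sub_int_mul_eq (x := y) ⌊a * y⌋
  have hy : y - ⌊a * y⌋ * (1 / a) = Int.fract (a * y) / a := by
    rw [Int.fract]
    field_simp
  simp only [hy] at h
  rw [← h]
  have h0 := Int.fract_nonneg (a * y)
  have h1 := Int.fract_lt_one (a * y)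
  rw [bernoulliTwoFract.eq_1 (a * y)]
  generalize Int.fract (a * y) = t at h0 h1
  have hterm : ∀ k ∈ Finset.range a, bernoulliTwoFract (t / a + k / a)
      = ((t + k) / a) ^ 2 - (t + k) / a + 1 / 6 := by
    intro k hk
    have hk : (k : ℝ) + 1 ≤ a := by exact_mod_cast Finset.mem_range.1 hk
    rw [← add_div, bernoulliTwoFract, Int.fract_eq_self.2 ⟨by positivity, ?_⟩]
    rw [div_lt_one ha']
    linarith
  have hsum (n : ℕ) (c : ℝ) : ∑ k ∈ Finset.range n, (((t + k) / c) ^ 2 - (t + k) / c + 1 / 6)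
      = (n * t ^ 2 + t * (n * (n - 1)) + n * (n - 1) * (2 * n - 1) / 6) / c ^ 2
        - (n * t + n * (n - 1) / 2) / c + n / 6 := by
    induction n with
    | zero => simp
    | succ n ih =>
      rw [Finset.sum_range_succ, ih]
      push_cast
      ring
  rw [Finset.sum_congr rfl hterm, hsum]
  field_simp
  ring

theorem sum_Sfun_add_div {a : ℕ} (ha : Odd a) (y : ℝ) :
    ∑ k ∈ Finset.range a, Sfun (y + k / a) = ((ZMod.χ₄ a : ℤ) : ℝ) / a * Sfun (a * y) := by
  have ha' : (0 : ℝ) < a := by exact_mod_cast ha.pos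
  have h1 := sum_bernoulliTwoFract_add_div ha.pos (y - 1 / 4)
  have h2 := sum_bernoulliTwoFract_add_div ha.pos (y + 1 / 4)
  have hsum : ∑ k ∈ Finset.range a, Sfun (y + k / a)
      = 4 * (bernoulliTwoFract (a * (y - 1 / 4)) / a
        - bernoulliTwoFract (a * (y + 1 / 4)) / a) := by
    rw [← h1, ← h2, ← Finset.sum_sub_distrib, Finset.mul_sum]
    refine Finset.sum_congr rfl fun k _ => ?_
    rw [Sfun_eq_bernoulliTwoFract_sub]
    ring_nf
  rw [hsum, Sfun_eq_bernoulliTwoFract_sub]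
  have hshift (x : ℝ) (n : ℤ) : bernoulliTwoFract (x + n) = bernoulliTwoFract x := by
    simpa using bernoulliTwoFract_periodic.int_mul n x
  have hdiv := Nat.div_add_mod a 4
  rcases Nat.odd_mod_four_iff.1 (Nat.odd_iff.1 ha) with h | h
  · have hq : (a : ℝ) = 4 * (a / 4 : ℕ) + 1 := by
      rw [h] at hdiv
      exact_mod_cast hdiv.symm
    have e1 : (a : ℝ) * (y - 1 / 4) = a * y - 1 / 4 + ((-(a / 4 : ℕ) : ℤ) : ℝ) := by
      push_cast only [Int.cast_neg, Int.cast_natCast]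
      linear_combination (-1 / 4) * hq
    have e2 : (a : ℝ) * (y + 1 / 4) = a * y + 1 / 4 + (((a / 4 : ℕ) : ℤ) : ℝ) := by
      rw [Int.cast_natCast]
      linear_combination (1 / 4) * hq
    rw [ZMod.χ₄_nat_one_mod_four h, e1, e2, hshift, hshift]
    push_cast
    ring
  · have hq : (a : ℝ) = 4 * (a / 4 : ℕ) + 3 := by
      rw [h] at hdiv
      exact_mod_cast hdiv.symm
    have e1 : (a : ℝ) * (y - 1 / 4) = a * y + 1 / 4 + ((-(a / 4 : ℕ) - 1 : ℤ) : ℝ) := by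
      rw [Int.cast_sub, Int.cast_neg, Int.cast_natCast, Int.cast_one]
      linear_combination (-1 / 4) * hq
    have e2 : (a : ℝ) * (y + 1 / 4) = a * y - 1 / 4 + (((a / 4 : ℕ) + 1 : ℤ) : ℝ) := by
      rw [Int.cast_add, Int.cast_natCast, Int.cast_one]
      linear_combination (1 / 4) * hq
    rw [ZMod.χ₄_nat_three_mod_four h, e1, e2, hshift, hshift]
    push_cast
    ring

theorem Function.Periodic.sum_range_mul_div {f : ℝ → ℝ} (hf : Function.Periodic f 1) {a b : ℕ}
    (ha : 0 < a) (hab : a.Coprime b) (y : ℝ) :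
    ∑ k ∈ Finset.range a, f (y + b * (k / a)) = ∑ k ∈ Finset.range a, f (y + k / a) := by
  have ha' : (0 : ℝ) < a := by exact_mod_cast ha
  have hmaps : Set.MapsTo (fun k => b * k % a) (Finset.range a) (Finset.range a) := by
    intro k _
    simpa using Nat.mod_lt _ ha
  have hinj : Set.InjOn (fun k => b * k % a) (Finset.range a : Set ℕ) := by
    intro k hk l hl hkl
    have h : k ≡ l [MOD a] := Nat.ModEq.cancel_left_of_coprime hab hkl
    simp only [Finset.coe_range, Set.mem_Iio] at hk hl
    exact Nat.ModEq.eq_of_lt_of_lt h hk hl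
  refine Finset.sum_nbij (fun k => b * k % a) hmaps hinj
    (Finset.surjOn_of_injOn_of_card_le _ hmaps hinj le_rfl) fun k _ => ?_
  have h : (b * k : ℝ) = a * (b * k / a : ℕ) + (b * k % a : ℕ) := by
    exact_mod_cast (Nat.div_add_mod (b * k) a).symm
  have h' : y + b * (k / a : ℝ) = y + (b * k % a : ℕ) / a + (b * k / a : ℕ) * 1 := by
    rw [← mul_div_assoc, h]
    field_simp
    ring
  rw [h', hf.nat_mul]

theorem Function.Periodic.integral_comp_nat_mul {f : ℝ → ℝ} (hf : Function.Periodic f 1)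
    (hc : Continuous f) {n : ℕ} (hn : 0 < n) :
    ∫ x in (0:ℝ)..1, f (n * x) = ∫ x in (0:ℝ)..1, f x := by
  have hn' : (n : ℝ) ≠ 0 := by exact_mod_cast hn.ne'
  rw [intervalIntegral.integral_comp_mul_left f hn']
  have h := hf.intervalIntegral_add_zsmul_eq n 0 fun _ _ => hc.intervalIntegrable _ _
  simp only [zero_add, natCast_zsmul, nsmul_eq_mul, mul_one] at h
  rw [mul_zero, mul_one, h, smul_eq_mul, inv_mul_cancel_left₀ hn']

theorem Function.Periodic.integral_comp_add {f : ℝ → ℝ} (hf : Function.Periodic f 1) (t : ℝ) :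
    ∫ x in (0:ℝ)..1, f (x + t) = ∫ x in (0:ℝ)..1, f x := by
  rw [intervalIntegral.integral_comp_add_right]
  simpa [add_comm] using hf.intervalIntegral_add_eq t 0

theorem Function.Periodic.comp_nat_mul {f : ℝ → ℝ} (hf : Function.Periodic f 1) (n : ℕ) :
    Function.Periodic (fun x => f (n * x)) 1 := fun x => by
  simpa [mul_add] using hf.nat_mul n (n * x)

theorem integral_comp_nat_mul_mul_Sfun {f : ℝ → ℝ} (hf : Function.Periodic f 1)
    (hc : Continuous f) {a b : ℕ} (ha : Odd a) (hab : a.Coprime b) :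
    ∫ x in (0:ℝ)..1, f (a * x) * Sfun (b * x)
      = ((ZMod.χ₄ a : ℤ) : ℝ) / (a : ℝ) ^ 2 * ∫ x in (0:ℝ)..1, f x * Sfun (b * x) := by
  have ha' : (a : ℝ) ≠ 0 := by exact_mod_cast ha.pos.ne'
  have hS := continuous_Sfun
  have hper : Function.Periodic (fun x => f (a * x) * Sfun (b * x)) 1 :=
    (hf.comp_nat_mul a).mul (Sfun_periodic.comp_nat_mul b)
  have hshift (k : ℕ) : ∫ x in (0:ℝ)..1, f (a * x) * Sfun (b * x + b * (k / a))
      = ∫ x in (0:ℝ)..1, f (a * x) * Sfun (b * x) := by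
    rw [← hper.integral_comp_add (k / a)]
    refine intervalIntegral.integral_congr fun x _ => ?_
    have h := hf.nat_mul k (a * x)
    rw [mul_one] at h
    simp only [mul_add, mul_div_cancel₀ _ ha', h]
  have hsum : (a : ℝ) * ∫ x in (0:ℝ)..1, f (a * x) * Sfun (b * x)
      = ((ZMod.χ₄ a : ℤ) : ℝ) / a * ∫ x in (0:ℝ)..1, f (a * x) * Sfun (b * (a * x)) := by
    calc (a : ℝ) * ∫ x in (0:ℝ)..1, f (a * x) * Sfun (b * x)
        = ∑ k ∈ Finset.range a,
            ∫ x in (0:ℝ)..1, f (a * x) * Sfun (b * x + b * (k / a)) := by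
          simp [hshift]
      _ = ∫ x in (0:ℝ)..1, ∑ k ∈ Finset.range a,
            f (a * x) * Sfun (b * x + b * (k / a)) := by
          refine (intervalIntegral.integral_finsetSum fun k _ => ?_).symm
          exact Continuous.intervalIntegrable (by fun_prop) _ _
      _ = ∫ x in (0:ℝ)..1,
            ((ZMod.χ₄ a : ℤ) : ℝ) / a * (f (a * x) * Sfun (b * (a * x))) := by
          refine intervalIntegral.integral_congr fun x _ => ?_
          rw [← Finset.mul_sum, Sfun_periodic.sum_range_mul_div ha.pos hab,
            sum_Sfun_add_div ha, mul_left_comm (a : ℝ)]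
          ring
      _ = _ := intervalIntegral.integral_const_mul _ _
  have hscale := (hf.mul (Sfun_periodic.comp_nat_mul b)).integral_comp_nat_mul (by fun_prop) ha.pos
  simp only [Pi.mul_apply] at hscale
  rw [hscale] at hsum
  apply mul_left_cancel₀ ha'
  rw [hsum]
  field_simp

theorem integral_Sfun_mul_self : ∫ x in (0:ℝ)..1, Sfun x * Sfun x = 1 / 3 := by
  have hS := continuous_Sfun
  have hint (s t : ℝ) : IntervalIntegrable (fun x => Sfun x * Sfun x) volume s t :=
    Continuous.intervalIntegrable (by fun_prop) _ _
  have e1 : ∫ x in (0:ℝ)..(1 / 4), Sfun x * Sfun x = ∫ x in (0:ℝ)..(1 / 4), 16 * x ^ 2 := by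
    refine intervalIntegral.integral_congr fun x hx => ?_
    rw [Set.uIcc_of_le (by norm_num)] at hx
    simp only [Sfun_eq_of_le hx.1 hx.2]
    ring
  have e2 : ∫ x in (1 / 4 : ℝ)..(3 / 4), Sfun x * Sfun x
      = ∫ x in (1 / 4 : ℝ)..(3 / 4), (16 * x ^ 2 - 16 * x + 4) := by
    refine intervalIntegral.integral_congr fun x hx => ?_
    rw [Set.uIcc_of_le (by norm_num)] at hx
    simp only [Sfun_eq_of_mem_middle hx.1 hx.2]
    ring
  have e3 : ∫ x in (3 / 4 : ℝ)..1, Sfun x * Sfun x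
      = ∫ x in (3 / 4 : ℝ)..1, (16 * x ^ 2 - 32 * x + 16) := by
    refine intervalIntegral.integral_congr fun x hx => ?_
    rw [Set.uIcc_of_le (by norm_num)] at hx
    simp only [Sfun_eq_of_ge hx.1 hx.2]
    ring
  have hpoly (p q r s t : ℝ) : ∫ x in s..t, (p * x ^ 2 - q * x + r)
      = p * ((t ^ 3 - s ^ 3) / 3) - q * ((t ^ 2 - s ^ 2) / 2) + r * (t - s) := by
    rw [intervalIntegral.integral_add (Continuous.intervalIntegrable (by fun_prop) _ _)
      (Continuous.intervalIntegrable (by fun_prop) _ _),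
      intervalIntegral.integral_sub (Continuous.intervalIntegrable (by fun_prop) _ _)
      (Continuous.intervalIntegrable (by fun_prop) _ _)]
    rw [intervalIntegral.integral_const_mul q fun x => x]
    simp only [intervalIntegral.integral_const_mul, integral_pow, integral_id,
      intervalIntegral.integral_const, smul_eq_mul]
    norm_num
    ring
  rw [← intervalIntegral.integral_add_adjacent_intervals (hint 0 (1 / 4)) (hint (1 / 4) 1),
    ← intervalIntegral.integral_add_adjacent_intervals (hint (1 / 4) (3 / 4)) (hint (3 / 4) 1),
    e1, e2, e3, hpoly, hpoly]
  rw [intervalIntegral.integral_const_mul, integral_pow]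
  norm_num

theorem integral_Sfun_mul_Sfun_of_coprime {a b : ℕ} (ha : Odd a) (hb : Odd b)
    (hab : a.Coprime b) :
    ∫ x in (0:ℝ)..1, Sfun (a * x) * Sfun (b * x)
      = ((ZMod.χ₄ a : ℤ) : ℝ) * ((ZMod.χ₄ b : ℤ) : ℝ) / (3 * (a : ℝ) ^ 2 * (b : ℝ) ^ 2) := by
  have h := integral_comp_nat_mul_mul_Sfun Sfun_periodic continuous_Sfun hb b.coprime_one_right
  simp only [Nat.cast_one, one_mul, integral_Sfun_mul_self] at h
  rw [integral_comp_nat_mul_mul_Sfun Sfun_periodic continuous_Sfun ha hab,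
    intervalIntegral.integral_congr fun x _ => mul_comm (Sfun x) (Sfun (b * x)), h]
  ring

/-- If both `i/gcd(i,j)` and `j/gcd(i,j)` are odd, then `|3⟨𝒮_i, 𝒮_j⟩| = gcd(i,j)⁴/(i²j²)`,
with `⟨𝒮_i, 𝒮_j⟩` negative if and only if `(i+j)/(2 gcd(i,j))` is even; in particular
`⟨𝒮_i, 𝒮_i⟩ = 1/3` for every `i ∈ ℕ`. -/
theorem inner_SS_of_odd_ratio (i j : ℕ) (hi : 0 < i) (hj : 0 < j)
    (h1 : Odd (i / Nat.gcd i j)) (h2 : Odd (j / Nat.gcd i j)) :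
    (|3 * ∫ x in (0:ℝ)..1, Sfun (i * x) * Sfun (j * x)|
        = (Nat.gcd i j : ℝ) ^ 4 / ((i : ℝ) ^ 2 * (j : ℝ) ^ 2)) ∧
    ((∫ x in (0:ℝ)..1, Sfun (i * x) * Sfun (j * x)) < 0 ↔
        Even ((i + j) / (2 * Nat.gcd i j))) ∧
    (∀ n : ℕ, 0 < n → ∫ x in (0:ℝ)..1, Sfun (n * x) * Sfun (n * x) = 1 / 3) := by
  have hS := continuous_Sfun
  obtain ⟨a, ha⟩ := Nat.gcd_dvd_left i j
  obtain ⟨b, hb⟩ := Nat.gcd_dvd_right i j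
  have hg : 0 < Nat.gcd i j := Nat.gcd_pos_of_pos_left j hi
  have hab : (i / Nat.gcd i j).Coprime (j / Nat.gcd i j) := Nat.coprime_div_gcd_div_gcd hg
  generalize Nat.gcd i j = g at *
  subst ha hb
  rw [Nat.mul_div_cancel_left _ hg] at h1 h2 hab
  rw [Nat.mul_div_cancel_left _ hg] at hab
  have hI : ∫ x in (0:ℝ)..1, Sfun ((g * a : ℕ) * x) * Sfun ((g * b : ℕ) * x)
      = ((ZMod.χ₄ a : ℤ) : ℝ) * ((ZMod.χ₄ b : ℤ) : ℝ) / (3 * (a : ℝ) ^ 2 * (b : ℝ) ^ 2) := by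
    have h := ((Sfun_periodic.comp_nat_mul a).mul
      (Sfun_periodic.comp_nat_mul b)).integral_comp_nat_mul (by fun_prop) hg
    simp only [Pi.mul_apply] at h
    rw [← integral_Sfun_mul_Sfun_of_coprime h1 h2 hab, ← h]
    refine intervalIntegral.integral_congr fun x _ => ?_
    simp only [Nat.cast_mul, mul_left_comm, mul_assoc]
  have hg' : (0 : ℝ) < g := by exact_mod_cast hg
  have ha' : (0 : ℝ) < a := by exact_mod_cast h1.pos
  have hb' : (0 : ℝ) < b := by exact_mod_cast h2.pos
  have hdiv : (g * a + g * b) / (2 * g) = (a + b) / 2 := by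
    rw [← mul_add, mul_comm 2 g, Nat.mul_div_mul_left _ _ hg]
  have hpos : 0 < 1 / (3 * (a : ℝ) ^ 2 * (b : ℝ) ^ 2) := by positivity
  have hval : (g : ℝ) ^ 4 / (((g * a : ℕ) : ℝ) ^ 2 * ((g * b : ℕ) : ℝ) ^ 2)
      = 3 * (1 / (3 * (a : ℝ) ^ 2 * (b : ℝ) ^ 2)) := by
    push_cast
    field_simp
  have hsign : ((ZMod.χ₄ a : ℤ) : ℝ) * ((ZMod.χ₄ b : ℤ) : ℝ) = 1 ∧ ¬ Even ((a + b) / 2) ∨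
      ((ZMod.χ₄ a : ℤ) : ℝ) * ((ZMod.χ₄ b : ℤ) : ℝ) = -1 ∧ Even ((a + b) / 2) := by
    rw [Nat.even_iff]
    rcases Nat.odd_mod_four_iff.1 (Nat.odd_iff.1 h1) with h | h <;>
      rcases Nat.odd_mod_four_iff.1 (Nat.odd_iff.1 h2) with h' | h' <;>
      simp only [ZMod.χ₄_nat_one_mod_four, ZMod.χ₄_nat_three_mod_four, h, h'] <;>
      norm_num <;> omega
  refine ⟨?_, ?_, fun n hn => ?_⟩
  · rw [hI, hval, abs_mul, abs_of_pos (by norm_num : (0 : ℝ) < 3)]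
    rcases hsign with ⟨h, -⟩ | ⟨h, -⟩
    · rw [h, abs_of_pos hpos]
    · rw [h, neg_div, abs_neg, abs_of_pos hpos]
  · rw [hI, hdiv]
    rcases hsign with ⟨h, h'⟩ | ⟨h, h'⟩
    · rw [h]
      exact iff_of_false hpos.not_gt h'
    · rw [h, neg_div]
      exact iff_of_true (neg_neg_of_pos hpos) h'
  · rw [← integral_Sfun_mul_self]
    exact (Sfun_periodic.mul Sfun_periodic).integral_comp_nat_mul (by fun_prop) hn
end

section
/- Let d ≥ 1. The normalized system consisting of the constant function 1 together with the functions x ↦ √3·𝒞(α·x) and x ↦ √3·𝒮(α·x), indexed by α ∈ ℤ^d with α ▹ 0, is a Riesz basis of L²([0,1]^d) with Riesz constants A = 1/2 and B = 3/2 independent of d. That is: (i) for every square-summable family of real coefficients a₀, (a_α)_{α▹0}, (b_α)_{α▹0}, the series f = a₀·1 + Σ_{α▹0} a_α √3 𝒞(α·x) + Σ_{α▹0} b_α √3 𝒮(α·x) converges in L²([0,1]^d) and (1/2)(a₀² + Σ_α a_α² + Σ_α b_α²) ≤ ‖f‖²_{L²([0,1]^d)} ≤ (3/2)(a₀² + Σ_α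 a_α² + Σ_α b_α²); and (ii) the closed linear span of this system is all of L²([0,1]^d). -/
open MeasureTheory Filter Topology

/-- `α ▹ 0`: the first nonzero entry of the integer vector `α` is positive. -/
def PosLead {d : ℕ} (α : Fin d → ℤ) : Prop :=
  ∃ i : Fin d, 0 < α i ∧ ∀ j : Fin d, j < i → α j = 0

section Abstract

variable {ι H : Type*} [NormedAddCommGroup H] [InnerProductSpace ℝ H]

theorem inner_eq_zero_of_hasSum {g : ι → H} {s y : H} (hg : HasSum g s)
    (h : ∀ i, inner ℝ y (g i) = 0) : inner ℝ y s = 0 := by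
  have h' := hg.mapL (innerSL ℝ y)
  simp only [innerSL_apply_apply, h] at h'
  exact h'.unique hasSum_zero

/-- A system obtained from an orthonormal one by a small perturbation along injective index maps
satisfies the Riesz inequalities. -/
theorem riesz_bounds_of_hasSum [CompleteSpace H] {φ f : ι → H} (hφ : Orthonormal ℝ φ)
    {m : ℕ → ι → ι} (hm : ∀ n, Function.Injective (m n)) {w : ℕ → ℝ} {S : ℝ}
    (hw : HasSum (fun n => |w n|) S) (hf : ∀ i, HasSum (fun n => w n • φ (m n i)) (f i))
    (hS : S ≤ 2 * |w 0|) {a : ι → ℝ} (ha : Summable fun i => a i ^ 2) :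
    Summable (fun i => a i • f i) ∧
      (2 * |w 0| - S) ^ 2 * ∑' i, a i ^ 2 ≤ ‖∑' i, a i • f i‖ ^ 2 ∧
      ‖∑' i, a i • f i‖ ^ 2 ≤ S ^ 2 * ∑' i, a i ^ 2 := by
  classical
  have hV : ∀ n, OrthogonalFamily ℝ (fun _ : ι => ℝ)
      fun i => LinearIsometry.toSpanSingleton ℝ H ((hφ.comp (m n) (hm n)).1 i) := fun n =>
    (hφ.comp (m n) (hm n)).orthogonalFamily
  let U : ℕ → lp (fun _ : ι => ℝ) 2 →L[ℝ] H := fun n => (hV n).linearIsometry.toContinuousLinearMap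
  have hU : ∀ n x, ‖U n x‖ = ‖x‖ := fun n x => (hV n).linearIsometry.norm_map x
  have hU1 : ∀ n, ‖U n‖ ≤ 1 := fun n => (hV n).linearIsometry.norm_toContinuousLinearMap_le
  have hle : ∀ n, ‖w n • U n‖ ≤ |w n| := fun n => by
    rw [norm_smul, Real.norm_eq_abs]
    exact mul_le_of_le_one_right (abs_nonneg _) (hU1 n)
  have hsum : Summable fun n => w n • U n := Summable.of_norm_bounded hw.summable hle
  obtain ⟨T, hT⟩ := hsum
  have hTx : ∀ x, HasSum (fun n => w n • U n x) (T x) := fun x =>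
    hT.mapL (ContinuousLinearMap.apply ℝ H x)
  have hTf : ∀ i c, T (lp.single 2 i c) = c • f i := fun i c => by
    refine (hTx _).unique ?_
    have h := (hf i).const_smul c
    refine h.congr_fun fun n => ?_
    have : U n (lp.single 2 i c) = c • φ (m n i) := by
      exact (hV n).linearIsometry_apply_single (i := i) c
    rw [this, smul_comm]
  let A : lp (fun _ : ι => ℝ) 2 := ⟨a, memℓp_gen (by simpa using ha)⟩
  have hA : ‖A‖ ^ 2 = ∑' i, a i ^ 2 := by
    have := lp.norm_rpow_eq_tsum (p := 2) (by norm_num) A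
    simpa [A] using this
  have hTA : HasSum (fun i => a i • f i) (T A) := by
    have := (lp.hasSum_single (p := 2) (by norm_num) A).mapL T
    simpa only [hTf, A] using this
  refine ⟨hTA.summable, ?_⟩
  rw [hTA.tsum_eq, ← hA, ← mul_pow, ← mul_pow]
  have hn : ∀ n, ‖w n • U n A‖ = |w n| * ‖A‖ := fun n => by
    rw [norm_smul, hU, Real.norm_eq_abs]
  have hs : HasSum (fun n => |w n| * ‖A‖) (S * ‖A‖) := hw.mul_right _
  constructor
  · have h1 : HasSum (fun n => w (n + 1) • U (n + 1) A) (T A - w 0 • U 0 A) := by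
      simpa using (hasSum_nat_add_iff' 1).2 (hTx A)
    have h2 : HasSum (fun n => |w (n + 1)| * ‖A‖) (S * ‖A‖ - |w 0| * ‖A‖) := by
      simpa using (hasSum_nat_add_iff' 1).2 hs
    have h3 : ‖T A - w 0 • U 0 A‖ ≤ S * ‖A‖ - |w 0| * ‖A‖ :=
      h1.norm_le_of_bounded h2 fun n => (hn _).le
    have h4 : ‖w 0 • U 0 A‖ ≤ ‖T A‖ + ‖T A - w 0 • U 0 A‖ := by
      have := norm_sub_le (T A) (T A - w 0 • U 0 A)
      simpa using this
    rw [hn] at h4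
    have h5 : 0 ≤ (2 * |w 0| - S) * ‖A‖ := mul_nonneg (by linarith) (norm_nonneg _)
    exact pow_le_pow_left₀ h5 (by linarith) 2
  · exact pow_le_pow_left₀ (norm_nonneg _) ((hTx A).norm_le_of_bounded hs fun n => (hn n).le) 2

/-- A vector orthogonal to a small perturbation of a bounded system is orthogonal to that
system. -/
theorem inner_eq_zero_of_inner_perturbation {φ f : ι → H} (hφ : ∀ i, ‖φ i‖ ≤ 1)
    {m : ℕ → ι → ι} (hm : ∀ i, m 0 i = i) {w : ℕ → ℝ} {S : ℝ}
    (hw : HasSum (fun n => |w n|) S) (hf : ∀ i, HasSum (fun n => w n • φ (m n i)) (f i))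
    (hS : S < 2 * |w 0|) {y : H} (hy : ∀ i, inner ℝ y (f i) = 0) (i : ι) :
    inner ℝ y (φ i) = 0 := by
  have : Nonempty ι := ⟨i⟩
  have hbdd : BddAbove (Set.range fun j => |inner ℝ y (φ j)|) := by
    refine ⟨‖y‖, ?_⟩
    rintro _ ⟨j, rfl⟩
    exact (abs_real_inner_le_norm _ _).trans
      (mul_le_of_le_one_right (norm_nonneg _) (hφ j))
  set M := ⨆ j, |inner ℝ y (φ j)|
  have hM : ∀ j, |inner ℝ y (φ j)| ≤ M := le_ciSup hbdd
  have hw1 : HasSum (fun n => |w (n + 1)|) (S - |w 0|) := by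
    simpa using (hasSum_nat_add_iff' 1).2 hw
  have key : ∀ j, |w 0| * |inner ℝ y (φ j)| ≤ (S - |w 0|) * M := fun j => by
    have h1 : HasSum (fun n => w n * inner ℝ y (φ (m n j))) 0 := by
      have := (hf j).mapL (innerSL ℝ y)
      simpa [hy, inner_smul_right] using this
    have h2 : HasSum (fun n => w (n + 1) * inner ℝ y (φ (m (n + 1) j)))
        (-(w 0 * inner ℝ y (φ j))) := by
      simpa [hm] using (hasSum_nat_add_iff' 1).2 h1
    have h3 := h2.norm_le_of_bounded (hw1.mul_right M) fun n => by
      rw [norm_mul, Real.norm_eq_abs, Real.norm_eq_abs]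
      exact mul_le_mul_of_nonneg_left (hM _) (abs_nonneg _)
    simpa [abs_mul] using h3
  have hS0 : |w 0| ≤ S := le_hasSum hw 0 fun _ _ => abs_nonneg _
  have h0 : 0 < |w 0| := by linarith
  have hMle : M ≤ (S - |w 0|) * M / |w 0| := ciSup_le fun j => by
    rw [le_div_iff₀ h0, mul_comm]
    exact key j
  have hM0 : 0 ≤ M := (abs_nonneg _).trans (hM i)
  rw [le_div_iff₀ h0] at hMle
  have : M ≤ 0 := by nlinarith
  exact abs_nonpos_iff.1 ((hM i).trans this)

end Abstract

section Wave

theorem Cfun_neg (x : ℝ) : Cfun (-x) = Cfun x := by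
  unfold Cfun
  by_cases h : Int.fract x = 0
  · rw [h, Int.fract_neg_eq_zero.2 h]
  · rw [Int.fract_neg h, abs_sub_comm]
    ring_nf

theorem Cfun_of_mem {t : ℝ} (h0 : 0 ≤ t) (h1 : t ≤ 1 / 2) : Cfun t = 1 - 4 * t := by
  rw [Cfun, Int.fract_eq_self.2 ⟨h0, by linarith⟩, abs_of_nonpos (by linarith)]
  ring

theorem Cfun_add_intCast (x : ℝ) (n : ℤ) : Cfun (x + n) = Cfun x := by
  simp [Cfun]

theorem Sfun_eq_Cfun (x : ℝ) : Sfun x = Cfun (x - 1 / 4) := by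
  have hx := Int.self_sub_floor x
  have h0 := Int.fract_nonneg x
  have h1 := Int.fract_lt_one x
  have hxt : x - 1 / 4 = (Int.fract x - 1 / 4) + (⌊x⌋ : ℤ) := by rw [← hx]; ring
  rw [hxt, Cfun_add_intCast, Sfun]
  generalize Int.fract x = t at h0 h1
  rcases le_total t (1 / 4) with h | h
  · rw [← Cfun_neg, Cfun_of_mem (by linarith) (by linarith), abs_of_nonpos (by linarith : t - 1/4 ≤ 0),
      abs_of_nonneg (by linarith)]
    ring
  rw [abs_of_nonneg (by linarith : 0 ≤ t - 1/4)]
  rcases le_total t (3 / 4) with h' | h'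
  · rw [Cfun_of_mem (by linarith) (by linarith), abs_of_nonneg (by linarith)]
    ring
  · have : Cfun (t - 1 / 4) = Cfun (1 - (t - 1 / 4)) := by
      rw [← Cfun_neg, ← Cfun_add_intCast _ 1]
      congr 1; push_cast; ring
    rw [this, Cfun_of_mem (by linarith) (by linarith), abs_of_nonpos (by linarith)]
    ring

theorem hasSum_cos_div_sq {t : ℝ} (ht : t ∈ Set.Icc (0 : ℝ) 1) :
    HasSum (fun n : ℕ => 1 / (n : ℝ) ^ 2 * Real.cos (2 * Real.pi * n * t))
      (Real.pi ^ 2 * (t ^ 2 - t + 1 / 6)) := by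
  have h := hasSum_one_div_nat_pow_mul_cos one_ne_zero ht
  have hb : (Polynomial.map (algebraMap ℚ ℝ) (Polynomial.bernoulli 2)).eval t
      = t ^ 2 - t + 1 / 6 := by
    simp [Polynomial.bernoulli_def, Finset.sum_range_succ, bernoulli_two, bernoulli_one]
    ring
  convert! h using 1
  rw [mul_one, hb]
  norm_num [Nat.factorial]
  left
  ring

/-- The Fourier series of the triangle wave `𝒞`. -/
theorem hasSum_odd_cos_div_sq (x : ℝ) :
    HasSum (fun n : ℕ => 1 / (2 * n + 1 : ℝ) ^ 2 * Real.cos (2 * Real.pi * ((2 * n + 1) * x)))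
      (Real.pi ^ 2 / 8 * Cfun x) := by
  have key : ∀ t : ℝ, 0 ≤ t → t ≤ 1 / 2 → HasSum (fun n : ℕ => 1 / (2 * n + 1 : ℝ) ^ 2 *
      Real.cos (2 * Real.pi * ((2 * n + 1) * t))) (Real.pi ^ 2 / 8 * Cfun t) := by
    intro t h0 h1
    have hall := hasSum_cos_div_sq (t := t) ⟨h0, by linarith⟩
    have heven := (hasSum_cos_div_sq (t := 2 * t) ⟨by linarith, by linarith⟩).mul_left (1 / 4)
    have hodd : Summable fun n : ℕ => 1 / (2 * n + 1 : ℝ) ^ 2 *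
        Real.cos (2 * Real.pi * ((2 * n + 1) * t)) := by
      have := hall.summable.comp_injective (i := fun n : ℕ => 2 * n + 1)
        (fun a b h => by simpa using h)
      refine this.congr fun n => ?_
      simp only [Function.comp_apply]
      push_cast
      ring_nf
    have hsum := HasSum.even_add_odd
      (f := fun n : ℕ => 1 / (n : ℝ) ^ 2 * Real.cos (2 * Real.pi * n * t))
      (heven.congr_fun fun n => by push_cast; rw [mul_pow]; ring_nf)
      (hodd.hasSum.congr_fun fun n => by push_cast; ring_nf)
    convert! hodd.hasSum using 1
    have := hsum.unique hall
    rw [Cfun_of_mem h0 h1]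
    linear_combination -this
  have hmain : ∀ t : ℝ, 0 ≤ t → t ≤ 1 → HasSum (fun n : ℕ => 1 / (2 * n + 1 : ℝ) ^ 2 *
      Real.cos (2 * Real.pi * ((2 * n + 1) * t))) (Real.pi ^ 2 / 8 * Cfun t) := by
    intro t h0 h1
    rcases le_total t (1 / 2) with h | h
    · exact key t h0 h
    · have hC : Cfun (1 - t) = Cfun t := by
        rw [← Cfun_neg t, ← Cfun_add_intCast (-t) 1]
        congr 1; push_cast; ring
      rw [← hC]
      refine (key (1 - t) (by linarith) (by linarith)).congr_fun fun n => ?_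
      congr 1
      rw [← Real.cos_neg, ← Real.cos_add_nat_mul_two_pi _ (2 * n + 1)]
      congr 1; push_cast; ring
  rw [← Int.fract_add_floor x, Cfun_add_intCast]
  refine (hmain _ (Int.fract_nonneg x) (Int.fract_lt_one x).le).congr_fun fun n => ?_
  congr 1
  rw [← Real.cos_add_int_mul_two_pi (2 * Real.pi * ((2 * n + 1) * Int.fract x))
    ((2 * n + 1) * ⌊x⌋)]
  congr 1; push_cast; ring

/-- The Fourier series of the triangle wave `𝒮`. -/
theorem hasSum_odd_sin_div_sq (x : ℝ) :
    HasSum (fun n : ℕ => (-1) ^ n / (2 * n + 1 : ℝ) ^ 2 *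
      Real.sin (2 * Real.pi * ((2 * n + 1) * x))) (Real.pi ^ 2 / 8 * Sfun x) := by
  rw [Sfun_eq_Cfun]
  refine (hasSum_odd_cos_div_sq (x - 1 / 4)).congr_fun fun n => ?_
  have : 2 * Real.pi * ((2 * n + 1) * (x - 1 / 4))
      = (2 * Real.pi * ((2 * n + 1) * x) - Real.pi / 2) - n * Real.pi := by ring
  rw [this, Real.cos_sub_nat_mul_pi, Real.cos_sub_pi_div_two]
  ring

theorem hasSum_odd_div_sq :
    HasSum (fun n : ℕ => 1 / (2 * n + 1 : ℝ) ^ 2) (Real.pi ^ 2 / 8) := by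
  simpa [Cfun_of_mem le_rfl] using hasSum_odd_cos_div_sq 0

end Wave

section PosLead

variable {d : ℕ} {α β : Fin d → ℤ}

theorem PosLead.add (hα : PosLead α) (hβ : PosLead β) : PosLead (α + β) := by
  obtain ⟨i, hi, hi'⟩ := hα
  obtain ⟨j, hj, hj'⟩ := hβ
  rcases lt_trichotomy i j with h | h | h
  · exact ⟨i, by simpa [hj' i h], fun k hk => by simp [hi' k hk, hj' k (hk.trans h)]⟩
  · subst h
    exact ⟨i, add_pos hi hj, fun k hk => by simp [hi' k hk, hj' k hk]⟩
  · exact ⟨j, by simpa [hi' j h], fun k hk => by simp [hj' k hk, hi' k (hk.trans h)]⟩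

theorem PosLead.ne_zero (hα : PosLead α) : α ≠ 0 := by
  obtain ⟨i, hi, -⟩ := hα
  rintro rfl
  simp at hi

theorem PosLead.smul (hα : PosLead α) {k : ℤ} (hk : 0 < k) : PosLead (k • α) := by
  obtain ⟨i, hi, hi'⟩ := hα
  exact ⟨i, by simpa using mul_pos hk hi, fun j hj => by simp [hi' j hj]⟩

theorem posLead_or_neg (hα : α ≠ 0) : PosLead α ∨ PosLead (-α) := by
  classical
  obtain ⟨i, hi⟩ := Function.ne_iff.1 hα
  obtain ⟨i, hi, hmin⟩ := WellFounded.has_min (wellFounded_lt (α := Fin d)) {i | α i ≠ 0} ⟨i, hi⟩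
  have hz : ∀ j < i, α j = 0 := fun j hj => by
    by_contra h
    exact hmin j h hj
  rcases lt_or_gt_of_ne (show α i ≠ 0 from hi) with h | h
  · exact .inr ⟨i, by simpa using h, fun j hj => by simp [hz j hj]⟩
  · exact .inl ⟨i, h, hz⟩

end PosLead

section Cube

/-- Lebesgue measure on the unit cube. -/
noncomputable abbrev cubeMeasure (d : ℕ) : Measure (Fin d → ℝ) := volume.restrict (Set.Icc 0 1)

/-- The linear form `x ↦ α · x` with integer coefficients. -/
def phase {d : ℕ} (α : Fin d → ℤ) (x : Fin d → ℝ) : ℝ := ∑ i, (α i : ℝ) * x i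

variable {d : ℕ}

theorem phase_zero (x : Fin d → ℝ) : phase 0 x = 0 := by simp [phase]

theorem phase_add (α β : Fin d → ℤ) (x : Fin d → ℝ) : phase (α + β) x = phase α x + phase β x := by
  simp [phase, add_mul, Finset.sum_add_distrib]

theorem phase_neg (α : Fin d → ℤ) (x : Fin d → ℝ) : phase (-α) x = -phase α x := by
  simp [phase]

theorem phase_sub (α β : Fin d → ℤ) (x : Fin d → ℝ) : phase (α - β) x = phase α x - phase β x := by
  rw [sub_eq_add_neg, phase_add, phase_neg, sub_eq_add_neg]

theorem phase_smul (k : ℤ) (α : Fin d → ℤ) (x : Fin d → ℝ) : phase (k • α) x = k * phase α x := by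
  simp [phase, Finset.mul_sum, mul_assoc]

@[fun_prop]
theorem continuous_phase (α : Fin d → ℤ) : Continuous (phase α) := by
  unfold phase
  fun_prop

theorem cubeMeasure_eq_pi : cubeMeasure d =
    Measure.pi fun _ : Fin d => (volume : Measure ℝ).restrict (Set.Ioc 0 1) := by
  rw [← Measure.restrict_pi_pi, ← volume_pi]
  exact (Measure.restrict_congr_set Measure.univ_pi_Ioc_ae_eq_Icc).symm

instance isProbabilityMeasure_cubeMeasure : IsProbabilityMeasure (cubeMeasure d) := by
  have : IsProbabilityMeasure ((volume : Measure ℝ).restrict (Set.Ioc 0 1)) := ⟨by simp⟩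
  rw [cubeMeasure_eq_pi]
  infer_instance

theorem integral_cexp_int_mul (n : ℤ) :
    ∫ t in Set.Ioc (0 : ℝ) 1, Complex.exp (2 * Real.pi * Complex.I * n * t)
      = if n = 0 then 1 else 0 := by
  rw [← intervalIntegral.integral_of_le zero_le_one]
  split_ifs with h
  · simp [h]
  · have hc : (2 * Real.pi * Complex.I * n : ℂ) ≠ 0 :=
      mul_ne_zero Complex.two_pi_I_ne_zero (Int.cast_ne_zero.2 h)
    rw [integral_exp_mul_complex hc]
    have : (2 * Real.pi * Complex.I * n * (1 : ℝ) : ℂ) = n * (2 * Real.pi * Complex.I) := by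
      push_cast; ring
    rw [this, Complex.exp_int_mul_two_pi_mul_I]
    simp

theorem integral_cexp_phase (α : Fin d → ℤ) :
    ∫ x, Complex.exp ((2 * Real.pi * phase α x : ℝ) * Complex.I) ∂cubeMeasure d
      = if α = 0 then 1 else 0 := by
  have h : ∀ x : Fin d → ℝ, Complex.exp ((2 * Real.pi * phase α x : ℝ) * Complex.I)
      = ∏ i, Complex.exp (2 * Real.pi * Complex.I * α i * x i) := fun x => by
    rw [← Complex.exp_sum, phase]
    push_cast
    rw [Finset.mul_sum, Finset.sum_mul]
    congr 1
    exact Finset.sum_congr rfl fun i _ => by ring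
  simp_rw [h]
  rw [cubeMeasure_eq_pi, integral_fintype_prod_eq_prod
    (f := fun i (t : ℝ) => Complex.exp (2 * Real.pi * Complex.I * α i * t))]
  simp_rw [integral_cexp_int_mul]
  split_ifs with h0
  · simp [h0]
  · obtain ⟨i, hi⟩ := Function.ne_iff.1 h0
    exact Finset.prod_eq_zero (Finset.mem_univ i) (if_neg hi)

theorem integrable_cexp_phase (α : Fin d → ℤ) :
    Integrable (fun x => Complex.exp ((2 * Real.pi * phase α x : ℝ) * Complex.I))
      (cubeMeasure d) := by
  refine Integrable.of_bound (C := 1) ?_ (.of_forall fun x => ?_)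
  · exact Continuous.aestronglyMeasurable (by fun_prop)
  · rw [Complex.norm_exp_ofReal_mul_I]

theorem integral_cos_phase (α : Fin d → ℤ) :
    ∫ x, Real.cos (2 * Real.pi * phase α x) ∂cubeMeasure d = if α = 0 then 1 else 0 := by
  have h := Complex.reCLM.integral_comp_comm (integrable_cexp_phase α)
  simp only [Complex.reCLM_apply, Complex.exp_ofReal_mul_I_re, integral_cexp_phase] at h
  rw [h]
  split_ifs <;> simp

theorem integral_sin_phase (α : Fin d → ℤ) :
    ∫ x, Real.sin (2 * Real.pi * phase α x) ∂cubeMeasure d = 0 := by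
  have h := Complex.imCLM.integral_comp_comm (integrable_cexp_phase α)
  simp only [Complex.imCLM_apply, Complex.exp_ofReal_mul_I_im, integral_cexp_phase] at h
  rw [h]
  split_ifs <;> simp

theorem integrable_cos_phase (α : Fin d → ℤ) :
    Integrable (fun x => Real.cos (2 * Real.pi * phase α x)) (cubeMeasure d) := by
  simpa only [Complex.reCLM_apply, Complex.exp_ofReal_mul_I_re] using
    Complex.reCLM.integrable_comp (integrable_cexp_phase α)

theorem integrable_sin_phase (α : Fin d → ℤ) :
    Integrable (fun x => Real.sin (2 * Real.pi * phase α x)) (cubeMeasure d) := by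
  simpa only [Complex.imCLM_apply, Complex.exp_ofReal_mul_I_im] using
    Complex.imCLM.integrable_comp (integrable_cexp_phase α)

/-- A square-integrable function on the cube all of whose Fourier coefficients vanish is zero. -/
theorem eq_zero_of_integral_phase_eq_zero {y : (Fin d → ℝ) → ℝ} (hy : MemLp y 2 (cubeMeasure d))
    (hcos : ∀ α, ∫ x, y x * Real.cos (2 * Real.pi * phase α x) ∂cubeMeasure d = 0)
    (hsin : ∀ α, ∫ x, y x * Real.sin (2 * Real.pi * phase α x) ∂cubeMeasure d = 0) :
    y =ᵐ[cubeMeasure d] 0 := by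
  have hs : MeasurableSet {x : Fin d → ℝ | ∀ i, x i ∈ Set.Ioc (0 : ℝ) (0 + 1)} := by
    have := MeasurableSet.univ_pi fun _ : Fin d => measurableSet_Ioc (a := (0 : ℝ)) (b := 0 + 1)
    convert! this
    grind
  have hrestr : volume.restrict {x : Fin d → ℝ | ∀ i, x i ∈ Set.Ioc (0 : ℝ) (0 + 1)}
      = cubeMeasure d := by
    have h : {x : Fin d → ℝ | ∀ i, x i ∈ Set.Ioc (0 : ℝ) (0 + 1)}
        = Set.univ.pi fun i => Set.Ioc ((0 : Fin d → ℝ) i) ((1 : Fin d → ℝ) i) := by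
      ext x; simp
    rw [h]
    exact Measure.restrict_congr_set Measure.univ_pi_Ioc_ae_eq_Icc
  have hσ := (measurePreserving_subtype_coe (μa := volume) hs).comp
    (UnitAddTorus.measurePreserving_equivPiIoc (fun _ : Fin d => (0 : ℝ)))
  have hemb := (MeasurableEmbedding.subtype_coe hs).comp
    (UnitAddTorus.measurableEquivPiIoc (fun _ : Fin d => (0 : ℝ))).measurableEmbedding
  rw [hrestr] at hσ
  set σ : UnitAddTorus (Fin d) → Fin d → ℝ :=
    Subtype.val ∘ UnitAddTorus.measurableEquivPiIoc (fun _ : Fin d => (0 : ℝ))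
  have hσcoe : ∀ t i, ((σ t i : ℝ) : UnitAddCircle) = t i := fun t i =>
    (AddCircle.equivIoc 1 (0 : ℝ)).symm_apply_apply (t i)
  have hG := (hy.ofReal (K := ℂ)).comp_measurePreserving hσ
  have hmono : ∀ n t, UnitAddTorus.mFourier n t
      = Complex.exp ((2 * Real.pi * phase n (σ t) : ℝ) * Complex.I) := fun n t => by
    have h1 : ∀ i, fourier (n i) (t i) = Complex.exp (2 * Real.pi * Complex.I * n i * σ t i) :=
      fun i => by rw [← hσcoe t i, fourier_coe_apply]; simp
    simp only [UnitAddTorus.mFourier, ContinuousMap.coe_mk, h1, ← Complex.exp_sum, phase]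
    push_cast
    rw [Finset.mul_sum, Finset.sum_mul]
    congr 1
    exact Finset.sum_congr rfl fun i _ => by ring
  have hy1 : Integrable y (cubeMeasure d) := hy.integrable one_le_two
  have hint : ∀ n, ∫ x, Complex.exp ((2 * Real.pi * phase n x : ℝ) * Complex.I) * (y x : ℂ)
      ∂cubeMeasure d = 0 := fun n => by
    have hi : Integrable (fun x => Complex.exp ((2 * Real.pi * phase n x : ℝ) * Complex.I)
        * (y x : ℂ)) (cubeMeasure d) :=
      hy1.ofReal.bdd_mul (c := 1) (Continuous.aestronglyMeasurable (by fun_prop))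
        (.of_forall fun x => (Complex.norm_exp_ofReal_mul_I _).le)
    have hre := Complex.reCLM.integral_comp_comm hi
    have him := Complex.imCLM.integral_comp_comm hi
    simp only [Complex.reCLM_apply, Complex.imCLM_apply, Complex.re_mul_ofReal,
      Complex.im_mul_ofReal, Complex.exp_ofReal_mul_I_re, Complex.exp_ofReal_mul_I_im,
      mul_comm _ (y _), hcos, hsin] at hre him
    exact Complex.ext hre.symm him.symm
  have hcoef : ∀ n, UnitAddTorus.mFourierCoeff (hG.toLp _) n = 0 := fun n => by
    rw [← hint (-n), ← hσ.integral_comp hemb]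
    refine integral_congr_ae ?_
    filter_upwards [hG.coeFn_toLp] with t ht
    rw [ht, hmono]
    rfl
  have hz : hG.toLp _ = 0 := by
    have := UnitAddTorus.hasSum_mFourier_series_L2 (hG.toLp _)
    simp only [hcoef, zero_smul] at this
    exact this.unique hasSum_zero
  have h0 := hG.coeFn_toLp
  rw [hz] at h0
  rw [Filter.EventuallyEq, ← hσ.map_eq, hemb.ae_map_iff]
  filter_upwards [h0, Lp.coeFn_zero ℂ 2 _] with t ht ht'
  rw [ht'] at ht
  simpa using ht.symm

end Cube

section System

variable {d : ℕ}

/-- The normalized cosine mode `√2 cos(2π α·x)`. -/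
noncomputable def cosMode (α : Fin d → ℤ) : BoundedContinuousFunction (Fin d → ℝ) ℝ :=
  .ofNormedAddCommGroup (fun x => √2 * Real.cos (2 * Real.pi * phase α x)) (by fun_prop) √2
    fun x => by
      rw [norm_mul, Real.norm_of_nonneg (Real.sqrt_nonneg 2)]
      exact mul_le_of_le_one_right (Real.sqrt_nonneg 2) (Real.abs_cos_le_one _)

/-- The normalized sine mode `√2 sin(2π α·x)`. -/
noncomputable def sinMode (α : Fin d → ℤ) : BoundedContinuousFunction (Fin d → ℝ) ℝ :=
  .ofNormedAddCommGroup (fun x => √2 * Real.sin (2 * Real.pi * phase α x)) (by fun_prop) √2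
    fun x => by
      rw [norm_mul, Real.norm_of_nonneg (Real.sqrt_nonneg 2)]
      exact mul_le_of_le_one_right (Real.sqrt_nonneg 2) (Real.abs_sin_le_one _)

theorem cosMode_apply (α : Fin d → ℤ) (x : Fin d → ℝ) :
    cosMode α x = √2 * Real.cos (2 * Real.pi * phase α x) := rfl

theorem sinMode_apply (α : Fin d → ℤ) (x : Fin d → ℝ) :
    sinMode α x = √2 * Real.sin (2 * Real.pi * phase α x) := rfl

theorem norm_cosMode_le (α : Fin d → ℤ) : ‖cosMode α‖ ≤ √2 :=
  BoundedContinuousFunction.norm_ofNormedAddCommGroup_le _ (Real.sqrt_nonneg 2) _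

theorem norm_sinMode_le (α : Fin d → ℤ) : ‖sinMode α‖ ≤ √2 :=
  BoundedContinuousFunction.norm_ofNormedAddCommGroup_le _ (Real.sqrt_nonneg 2) _

/-- The class in `L²` of the unit cube of a bounded continuous function. -/
noncomputable abbrev cubeLp (g : BoundedContinuousFunction (Fin d → ℝ) ℝ) :
    Lp ℝ 2 (cubeMeasure d) :=
  BoundedContinuousFunction.toLp 2 (cubeMeasure d) ℝ g

theorem inner_cubeLp (f g : BoundedContinuousFunction (Fin d → ℝ) ℝ) :
    inner ℝ (cubeLp f) (cubeLp g) = ∫ x, f x * g x ∂cubeMeasure d := by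
  rw [cubeLp, cubeLp, BoundedContinuousFunction.inner_toLp]
  simp [mul_comm]

theorem inner_cosMode_cosMode (α β : Fin d → ℤ) :
    inner ℝ (cubeLp (cosMode α)) (cubeLp (cosMode β))
      = (if α - β = 0 then 1 else 0) + if α + β = 0 then 1 else 0 := by
  rw [inner_cubeLp, ← integral_cos_phase, ← integral_cos_phase,
    ← integral_add (integrable_cos_phase _) (integrable_cos_phase _)]
  congr 1 with x
  rw [cosMode_apply, cosMode_apply, phase_add, phase_sub, mul_sub, mul_add, Real.cos_sub,
    Real.cos_add]
  linear_combination Real.cos (2 * Real.pi * phase α x) * Real.cos (2 * Real.pi * phase β x) *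
    Real.sq_sqrt (show (0 : ℝ) ≤ 2 by norm_num)

theorem inner_sinMode_sinMode (α β : Fin d → ℤ) :
    inner ℝ (cubeLp (sinMode α)) (cubeLp (sinMode β))
      = (if α - β = 0 then 1 else 0) - if α + β = 0 then 1 else 0 := by
  rw [inner_cubeLp, ← integral_cos_phase, ← integral_cos_phase,
    ← integral_sub (integrable_cos_phase _) (integrable_cos_phase _)]
  congr 1 with x
  rw [sinMode_apply, sinMode_apply, phase_add, phase_sub, mul_sub, mul_add, Real.cos_sub,
    Real.cos_add]
  linear_combination Real.sin (2 * Real.pi * phase α x) * Real.sin (2 * Real.pi * phase β x) *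
    Real.sq_sqrt (show (0 : ℝ) ≤ 2 by norm_num)

theorem inner_cosMode_sinMode (α β : Fin d → ℤ) :
    inner ℝ (cubeLp (cosMode α)) (cubeLp (sinMode β)) = 0 := by
  rw [inner_cubeLp, ← sub_zero (0 : ℝ)]
  nth_rw 1 [← integral_sin_phase (α + β)]
  rw [← integral_sin_phase (α - β),
    ← integral_sub (integrable_sin_phase _) (integrable_sin_phase _)]
  congr 1 with x
  rw [cosMode_apply, sinMode_apply, phase_add, phase_sub, mul_sub, mul_add, Real.sin_sub,
    Real.sin_add]
  linear_combination Real.cos (2 * Real.pi * phase α x) * Real.sin (2 * Real.pi * phase β x) *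
    Real.sq_sqrt (show (0 : ℝ) ≤ 2 by norm_num)

theorem inner_const_cosMode {α : Fin d → ℤ} (hα : α ≠ 0) :
    inner ℝ (cubeLp (.const _ 1)) (cubeLp (cosMode α)) = 0 := by
  simp [inner_cubeLp, cosMode_apply, integral_const_mul, integral_cos_phase, hα]

theorem inner_const_sinMode (α : Fin d → ℤ) :
    inner ℝ (cubeLp (.const _ 1)) (cubeLp (sinMode α)) = 0 := by
  simp [inner_cubeLp, sinMode_apply, integral_const_mul, integral_sin_phase]

theorem norm_cubeLp_const : ‖cubeLp (d := d) (.const _ 1)‖ = 1 := by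
  have h : inner ℝ (cubeLp (d := d) (.const _ 1)) (cubeLp (d := d) (.const _ 1)) = 1 := by
    rw [inner_cubeLp]
    simp
  rw [real_inner_self_eq_norm_sq] at h
  exact (pow_eq_one_iff_of_nonneg (norm_nonneg _) two_ne_zero).1 h

theorem orthonormal_cosMode :
    Orthonormal ℝ fun α : {α : Fin d → ℤ // PosLead α} => cubeLp (cosMode (α : Fin d → ℤ)) := by
  classical
  rw [orthonormal_iff_ite]
  intro α β
  rw [inner_cosMode_cosMode, if_neg (α.2.add β.2).ne_zero, add_zero]
  simp [sub_eq_zero, Subtype.ext_iff]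

theorem orthonormal_sinMode :
    Orthonormal ℝ fun α : {α : Fin d → ℤ // PosLead α} => cubeLp (sinMode (α : Fin d → ℤ)) := by
  classical
  rw [orthonormal_iff_ite]
  intro α β
  rw [inner_sinMode_sinMode, if_neg (α.2.add β.2).ne_zero, sub_zero]
  simp [sub_eq_zero, Subtype.ext_iff]

/-- The odd multiples of a positive multi-index. -/
def oddMultiple (n : ℕ) (α : {α : Fin d → ℤ // PosLead α}) : {α : Fin d → ℤ // PosLead α} :=
  ⟨(2 * n + 1 : ℤ) • (α : Fin d → ℤ), α.2.smul (by positivity)⟩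

theorem oddMultiple_zero (α : {α : Fin d → ℤ // PosLead α}) : oddMultiple 0 α = α := by
  simp [oddMultiple]

theorem oddMultiple_injective (n : ℕ) :
    Function.Injective (oddMultiple n : {α : Fin d → ℤ // PosLead α} → _) := fun α β h => by
  have h' : (2 * n + 1 : ℤ) • (α : Fin d → ℤ) = (2 * n + 1 : ℤ) • (β : Fin d → ℤ) :=
    congrArg Subtype.val h
  exact Subtype.ext (smul_right_injective _ (by positivity : (2 * n + 1 : ℤ) ≠ 0) h')

/-- The common factor of the Fourier coefficients of the normalized triangle waves. -/
noncomputable def waveCoeff : ℝ := 4 * √6 / Real.pi ^ 2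

theorem waveCoeff_pos : 0 < waveCoeff := by unfold waveCoeff; positivity

theorem waveCoeff_mul : waveCoeff * (Real.pi ^ 2 / 8) = √6 / 2 := by
  unfold waveCoeff
  field_simp
  norm_num

theorem waveCoeff_mul_sqrt_two : waveCoeff * √2 * (Real.pi ^ 2 / 8) = √3 := by
  rw [mul_right_comm, waveCoeff_mul, show (6 : ℝ) = 3 * 2 by norm_num,
    Real.sqrt_mul (by norm_num)]
  linear_combination √3 / 2 * Real.sq_sqrt (show (0 : ℝ) ≤ 2 by norm_num)

theorem four_fifths_le_eight_div_pi_sq : 4 / 5 ≤ 8 / Real.pi ^ 2 := by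
  rw [le_div_iff₀ (by positivity)]
  nlinarith [Real.pi_lt_d2, Real.pi_pos]

theorem two_mul_waveCoeff : 2 * waveCoeff = √6 * (8 / Real.pi ^ 2) := by
  unfold waveCoeff
  ring

theorem sq_two_mul_waveCoeff_sub : 1 / 2 ≤ (2 * waveCoeff - √6 / 2) ^ 2 := by
  have h : 2 * waveCoeff - √6 / 2 = √6 * (8 / Real.pi ^ 2 - 1 / 2) := by
    rw [two_mul_waveCoeff]
    ring
  rw [h, mul_pow, Real.sq_sqrt (by norm_num)]
  nlinarith [four_fifths_le_eight_div_pi_sq]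

theorem sqrt_six_div_two_lt : √6 / 2 < 2 * waveCoeff := by
  have h : (0 : ℝ) < √6 := by positivity
  rw [two_mul_waveCoeff]
  nlinarith [four_fifths_le_eight_div_pi_sq]

theorem hasSum_abs_cosWeight :
    HasSum (fun n : ℕ => |waveCoeff / (2 * n + 1 : ℝ) ^ 2|) (√6 / 2) := by
  rw [← waveCoeff_mul]
  refine (hasSum_odd_div_sq.mul_left waveCoeff).congr_fun fun n => ?_
  rw [abs_of_nonneg (div_nonneg waveCoeff_pos.le (sq_nonneg _)), mul_one_div]

theorem hasSum_abs_sinWeight :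
    HasSum (fun n : ℕ => |waveCoeff * (-1) ^ n / (2 * n + 1 : ℝ) ^ 2|) (√6 / 2) := by
  refine hasSum_abs_cosWeight.congr_fun fun n => ?_
  simp [abs_div, abs_mul]

theorem hasSum_cubeLp_of_pointwise {w : ℕ → ℝ} {S : ℝ} (hw : HasSum (fun n => |w n|) S)
    {g : ℕ → BoundedContinuousFunction (Fin d → ℝ) ℝ} {C : ℝ} (hg : ∀ n, ‖g n‖ ≤ C)
    {F : (Fin d → ℝ) → ℝ} (hF : ∀ x, HasSum (fun n => w n * g n x) (F x))
    {e : Lp ℝ 2 (cubeMeasure d)} (he : e =ᵐ[cubeMeasure d] F) :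
    HasSum (fun n => w n • cubeLp (g n)) e := by
  have hsum : Summable fun n => w n • g n :=
    Summable.of_norm_bounded (hw.summable.mul_right C) fun n => by
      rw [norm_smul, Real.norm_eq_abs]
      exact mul_le_mul_of_nonneg_left (hg n) (abs_nonneg _)
  obtain ⟨G, hG⟩ := hsum
  have hGF : ∀ x, G x = F x := fun x => by
    have h := hG.mapL (BoundedContinuousFunction.evalCLM ℝ x)
    exact h.unique (hF x)
  have hGe : cubeLp G = e := Lp.ext <| by
    filter_upwards [BoundedContinuousFunction.coeFn_toLp 2 (cubeMeasure d) ℝ G, he] with x h1 h2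
    rw [h1, h2, hGF]
  rw [← hGe]
  simpa using hG.mapL (BoundedContinuousFunction.toLp 2 (cubeMeasure d) ℝ)

theorem hasSum_cosMode (α : {α : Fin d → ℤ // PosLead α}) {e : Lp ℝ 2 (cubeMeasure d)}
    (he : e =ᵐ[cubeMeasure d] fun x => √3 * Cfun (phase (α : Fin d → ℤ) x)) :
    HasSum (fun n : ℕ => (waveCoeff / (2 * n + 1 : ℝ) ^ 2) •
      cubeLp (cosMode (oddMultiple n α : Fin d → ℤ))) e := by
  refine hasSum_cubeLp_of_pointwise hasSum_abs_cosWeight (fun n => norm_cosMode_le _)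
    (fun x => ?_) he
  rw [← waveCoeff_mul_sqrt_two, mul_assoc]
  refine ((hasSum_odd_cos_div_sq _).mul_left _).congr_fun fun n => ?_
  rw [cosMode_apply, oddMultiple, phase_smul]
  push_cast
  ring

theorem hasSum_sinMode (α : {α : Fin d → ℤ // PosLead α}) {e : Lp ℝ 2 (cubeMeasure d)}
    (he : e =ᵐ[cubeMeasure d] fun x => √3 * Sfun (phase (α : Fin d → ℤ) x)) :
    HasSum (fun n : ℕ => (waveCoeff * (-1) ^ n / (2 * n + 1 : ℝ) ^ 2) •
      cubeLp (sinMode (oddMultiple n α : Fin d → ℤ))) e := by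
  refine hasSum_cubeLp_of_pointwise hasSum_abs_sinWeight (fun n => norm_sinMode_le _)
    (fun x => ?_) he
  rw [← waveCoeff_mul_sqrt_two, mul_assoc]
  refine ((hasSum_odd_sin_div_sq _).mul_left _).congr_fun fun n => ?_
  rw [sinMode_apply, oddMultiple, phase_smul]
  push_cast
  ring

theorem inner_cubeLp_eq_integral (y : Lp ℝ 2 (cubeMeasure d))
    (g : BoundedContinuousFunction (Fin d → ℝ) ℝ) :
    inner ℝ y (cubeLp g) = ∫ x, y x * g x ∂cubeMeasure d := by
  rw [MeasureTheory.L2.inner_def]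
  refine integral_congr_ae ?_
  filter_upwards [BoundedContinuousFunction.coeFn_toLp 2 (cubeMeasure d) ℝ g] with x hx
  rw [hx]
  simp [mul_comm]

/-- The trigonometric system is complete in `L²` of the unit cube. -/
theorem eq_zero_of_inner_modes_eq_zero {y : Lp ℝ 2 (cubeMeasure d)}
    (h1 : inner ℝ y (cubeLp (.const _ 1)) = 0)
    (hcos : ∀ α : {α : Fin d → ℤ // PosLead α},
      inner ℝ y (cubeLp (cosMode (α : Fin d → ℤ))) = 0)
    (hsin : ∀ α : {α : Fin d → ℤ // PosLead α},
      inner ℝ y (cubeLp (sinMode (α : Fin d → ℤ))) = 0) : y = 0 := by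
  have h2 : √2 ≠ 0 := by positivity
  simp only [inner_cubeLp_eq_integral, cosMode_apply, sinMode_apply, mul_left_comm _ (√2),
    integral_const_mul, mul_eq_zero, h2, false_or, BoundedContinuousFunction.const_apply,
    mul_one] at h1 hcos hsin
  refine (Lp.eq_zero_iff_ae_eq_zero).2
    (eq_zero_of_integral_phase_eq_zero (Lp.memLp y) (fun α => ?_) fun α => ?_)
  all_goals
    rcases eq_or_ne α 0 with rfl | hα
    · simp [phase_zero, h1]
    rcases posLead_or_neg hα with h | h
  · exact hcos ⟨α, h⟩
  · simpa [phase_neg] using hcos ⟨-α, h⟩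
  · exact hsin ⟨α, h⟩
  · simpa [phase_neg, integral_neg] using hsin ⟨-α, h⟩

end System

theorem norm_sq_add_add_of_inner_eq_zero {H : Type*} [NormedAddCommGroup H]
    [InnerProductSpace ℝ H] {x y z : H} (hxy : inner ℝ x y = 0) (hxz : inner ℝ x z = 0)
    (hyz : inner ℝ y z = 0) : ‖x + y + z‖ ^ 2 = ‖x‖ ^ 2 + ‖y‖ ^ 2 + ‖z‖ ^ 2 := by
  rw [norm_add_sq_real, norm_add_sq_real, inner_add_left, hxy, hxz, hyz]
  ring

/-- The normalized system `{1} ∪ {√3 𝒞(α·x) : α ▹ 0} ∪ {√3 𝒮(α·x) : α ▹ 0}` is a Riesz basis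
of `L²([0,1]^d)` with Riesz constants `A = 1/2` and `B = 3/2`, independent of `d`: every
square-summable coefficient family gives a series converging in `L²([0,1]^d)` whose squared
norm is bounded below and above by `1/2` resp. `3/2` times the sum of squares of the
coefficients, and the closed linear span of the system is the whole space. -/
theorem riesz_basis_multivariate (d : ℕ) (hd : 1 ≤ d)
    (μ : Measure (Fin d → ℝ)) (hμ : μ = volume.restrict (Set.Icc 0 1))
    (e1 : Lp ℝ 2 μ) (eC eS : {α : Fin d → ℤ // PosLead α} → Lp ℝ 2 μ)
    (h1 : (e1 : (Fin d → ℝ) → ℝ) =ᵐ[μ] fun _ => 1)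
    (hC : ∀ α : {α : Fin d → ℤ // PosLead α},
      (eC α : (Fin d → ℝ) → ℝ) =ᵐ[μ] fun x => Real.sqrt 3 * Cfun (∑ i, ((α : Fin d → ℤ) i : ℝ) * x i))
    (hS : ∀ α : {α : Fin d → ℤ // PosLead α},
      (eS α : (Fin d → ℝ) → ℝ) =ᵐ[μ] fun x => Real.sqrt 3 * Sfun (∑ i, ((α : Fin d → ℤ) i : ℝ) * x i)) :
    (∀ (a0 : ℝ) (a b : {α : Fin d → ℤ // PosLead α} → ℝ),
      Summable (fun α => (a α) ^ 2) → Summable (fun α => (b α) ^ 2) →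
      Summable (fun α => a α • eC α) ∧ Summable (fun α => b α • eS α) ∧
      (1 / 2) * (a0 ^ 2 + ∑' α, (a α) ^ 2 + ∑' α, (b α) ^ 2)
          ≤ ‖a0 • e1 + (∑' α, a α • eC α) + ∑' α, b α • eS α‖ ^ 2 ∧
      ‖a0 • e1 + (∑' α, a α • eC α) + ∑' α, b α • eS α‖ ^ 2
          ≤ (3 / 2) * (a0 ^ 2 + ∑' α, (a α) ^ 2 + ∑' α, (b α) ^ 2)) ∧
    (Submodule.span ℝ ({e1} ∪ Set.range eC ∪ Set.range eS)).topologicalClosure = ⊤ := by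
  subst hμ
  have he1 : e1 = cubeLp (.const _ 1) := Lp.ext <| by
    filter_upwards [h1, BoundedContinuousFunction.coeFn_toLp 2 (cubeMeasure d) ℝ
      (.const (Fin d → ℝ) (1 : ℝ))] with x hx hx'
    rw [hx, hx', BoundedContinuousFunction.const_apply]
  have hCsum := fun α => hasSum_cosMode α (hC α)
  have hSsum := fun α => hasSum_sinMode α (hS α)
  have hw0 : |waveCoeff / (2 * (0 : ℕ) + 1 : ℝ) ^ 2| = waveCoeff := by
    simp [abs_of_pos waveCoeff_pos]
  have hw0' : |waveCoeff * (-1) ^ 0 / (2 * (0 : ℕ) + 1 : ℝ) ^ 2| = waveCoeff := by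
    simp [abs_of_pos waveCoeff_pos]
  have h1C : ∀ α, inner ℝ e1 (eC α) = 0 := fun α => inner_eq_zero_of_hasSum (hCsum α) fun n => by
    rw [inner_smul_right, he1, inner_const_cosMode (oddMultiple n α).2.ne_zero, mul_zero]
  have h1S : ∀ α, inner ℝ e1 (eS α) = 0 := fun α => inner_eq_zero_of_hasSum (hSsum α) fun n => by
    rw [inner_smul_right, he1, inner_const_sinMode, mul_zero]
  have hCS : ∀ α β, inner ℝ (eC α) (eS β) = 0 := fun α β =>
    inner_eq_zero_of_hasSum (hSsum β) fun n => by
      rw [inner_smul_right, real_inner_comm, inner_eq_zero_of_hasSum (hCsum α), mul_zero]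
      intro k
      rw [inner_smul_right, real_inner_comm, inner_cosMode_sinMode, mul_zero]
  constructor
  · intro a0 a b ha hb
    obtain ⟨hsa, hla, hua⟩ := riesz_bounds_of_hasSum orthonormal_cosMode oddMultiple_injective
      hasSum_abs_cosWeight hCsum (by rw [hw0]; exact sqrt_six_div_two_lt.le) ha
    obtain ⟨hsb, hlb, hub⟩ := riesz_bounds_of_hasSum orthonormal_sinMode oddMultiple_injective
      hasSum_abs_sinWeight hSsum (by rw [hw0']; exact sqrt_six_div_two_lt.le) hb
    rw [hw0] at hla
    rw [hw0'] at hlb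
    refine ⟨hsa, hsb, ?_⟩
    have hnorm := norm_sq_add_add_of_inner_eq_zero
      (x := a0 • e1) (y := ∑' α, a α • eC α) (z := ∑' α, b α • eS α)
      (inner_eq_zero_of_hasSum hsa.hasSum fun α => by
        rw [inner_smul_left, inner_smul_right, h1C, mul_zero, mul_zero])
      (inner_eq_zero_of_hasSum hsb.hasSum fun α => by
        rw [inner_smul_left, inner_smul_right, h1S, mul_zero, mul_zero])
      (inner_eq_zero_of_hasSum hsb.hasSum fun β => by
        rw [inner_smul_right, real_inner_comm, inner_eq_zero_of_hasSum hsa.hasSum, mul_zero]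
        intro α
        rw [inner_smul_right, real_inner_comm, hCS, mul_zero])
    have he : ‖a0 • e1‖ ^ 2 = a0 ^ 2 := by
      rw [norm_smul, he1, norm_cubeLp_const, mul_one, Real.norm_eq_abs, sq_abs]
    have h6 : (√6 / 2) ^ 2 = 3 / 2 := by
      rw [div_pow, Real.sq_sqrt (by norm_num)]
      norm_num
    rw [h6] at hua hub
    have hA : 0 ≤ ∑' α, a α ^ 2 := tsum_nonneg fun α => sq_nonneg _
    have hB : 0 ≤ ∑' α, b α ^ 2 := tsum_nonneg fun α => sq_nonneg _
    have hla' := (mul_le_mul_of_nonneg_right sq_two_mul_waveCoeff_sub hA).trans hla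
    have hlb' := (mul_le_mul_of_nonneg_right sq_two_mul_waveCoeff_sub hB).trans hlb
    rw [hnorm, he]
    constructor <;> nlinarith [sq_nonneg a0]
  · rw [Submodule.topologicalClosure_eq_top_iff, Submodule.eq_bot_iff]
    intro y hy
    have hy' : ∀ v ∈ {e1} ∪ Set.range eC ∪ Set.range eS, inner ℝ y v = 0 := fun v hv =>
      Submodule.inner_left_of_mem_orthogonal (Submodule.subset_span hv) hy
    refine eq_zero_of_inner_modes_eq_zero ?_ ?_ ?_
    · rw [← he1]
      exact hy' _ (by simp)
    · exact inner_eq_zero_of_inner_perturbation (fun α => (orthonormal_cosMode.1 α).le)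
        oddMultiple_zero hasSum_abs_cosWeight hCsum (by rw [hw0]; exact sqrt_six_div_two_lt)
        fun α => hy' _ (by simp)
    · exact inner_eq_zero_of_inner_perturbation (fun α => (orthonormal_sinMode.1 α).le)
        oddMultiple_zero hasSum_abs_sinWeight hSsum (by rw [hw0']; exact sqrt_six_div_two_lt)
        fun α => hy' _ (by simp)
end
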